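/- Let x, y, q be complex numbers with |q| < 1, and suppose y·q^(2k+1) ≠ 1 for every integer k ≥ 0. Then Σ_{i,j≥0} x^i · y^(i+2j) · q^(2i²+4j²+4ij−i) / ((q²;q²)_i · (q⁴;q⁴)_j) = (yq;q²)_∞ · Σ_{j≥0} (−x;q²)_j · y^j · q^(j²) / ((yq;q²)_j · (q²;q²)_j). -/

import Mathlib

/-- Finite q-Pochhammer symbol `(a; q)_n = ∏_{k=0}^{n-1} (1 - a q^k)`. -/
noncomputable def qPoch (a q : ℂ) (n : ℕ) : ℂ := ∏ k ∈ Finset.range n, (1 - a * q ^ k)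

/-- Infinite q-Pochhammer symbol `(a; q)_∞ = ∏_{k=0}^{∞} (1 - a q^k)`. -/
noncomputable def qPochInf (a q : ℂ) : ℂ := ∏' k : ℕ, (1 - a * q ^ k)

/-- A convergent series may be summed along the fibres of a map with finite fibres. -/
theorem HasSum.sum_fiberwise_finset {β γ : Type*} {f : β → ℂ} {a : ℂ} (hf : HasSum f a)
    (g : β → γ) (s : γ → Finset β) (hs : ∀ c b, b ∈ s c ↔ g b = c) :
    HasSum (fun c => ∑ b ∈ s c, f b) a := by
  have h : (fun c => ∑ b ∈ s c, f b) = fun c => ∑' b : g ⁻¹' {c}, f b := by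
    funext c
    have hc : g ⁻¹' {c} = (s c : Set β) := by
      ext b
      simp [hs]
    rw [hc]
    exact (Finset.tsum_subtype' (s c) f).symm
  rw [h]
  exact hf.tsum_fiberwise g

theorem qPoch_zero (a q : ℂ) : qPoch a q 0 = 1 := by simp [qPoch]

theorem qPoch_succ (a q : ℂ) (n : ℕ) : qPoch a q (n + 1) = qPoch a q n * (1 - a * q ^ n) := by
  simp [qPoch, Finset.prod_range_succ]

theorem one_sub_pow_succ_ne_zero {p : ℂ} (hp : ‖p‖ < 1) (n : ℕ) : 1 - p ^ (n + 1) ≠ 0 := by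
  intro h
  have h1 : ‖p ^ (n + 1)‖ < 1 := by
    rw [norm_pow]
    exact pow_lt_one₀ (norm_nonneg _) hp (by simp)
  rw [← sub_eq_zero.mp h] at h1
  simp at h1

theorem qPoch_self_ne_zero {p : ℂ} (hp : ‖p‖ < 1) (n : ℕ) : qPoch p p n ≠ 0 := by
  rw [qPoch, Finset.prod_ne_zero_iff]
  intro k _
  rw [← pow_succ']
  exact one_sub_pow_succ_ne_zero hp k

theorem inv_qPoch_self_succ {p : ℂ} (hp : ‖p‖ < 1) (n : ℕ) :
    (qPoch p p (n + 1))⁻¹ * (1 - p ^ (n + 1)) = (qPoch p p n)⁻¹ := by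
  have h1 := one_sub_pow_succ_ne_zero hp n
  have h2 := qPoch_self_ne_zero hp n
  rw [qPoch_succ, ← pow_succ']
  field_simp

theorem norm_inv_qPoch_self_le {p : ℂ} (hp : ‖p‖ < 1) (n : ℕ) :
    ‖(qPoch p p n)⁻¹‖ ≤ ((1 - ‖p‖)⁻¹) ^ n := by
  have h0 : 0 < 1 - ‖p‖ := by linarith
  rw [norm_inv, inv_pow]
  refine inv_anti₀ (pow_pos h0 n) ?_
  rw [qPoch, norm_prod]
  calc (1 - ‖p‖) ^ n = ∏ _k ∈ Finset.range n, (1 - ‖p‖) := by simp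
    _ ≤ _ := by
      refine Finset.prod_le_prod (fun _ _ => h0.le) fun k _ => ?_
      have h1 : ‖p * p ^ k‖ ≤ ‖p‖ := by
        rw [norm_mul, norm_pow]
        exact mul_le_of_le_one_right (norm_nonneg _) (pow_le_one₀ (norm_nonneg _) hp.le)
      have h2 := norm_sub_norm_le (1 : ℂ) (p * p ^ k)
      rw [norm_one] at h2
      linarith

open PowerSeries in
/-- The functional equation of `∑ zⁿ / (p; p)_n`. -/
theorem rescale_mk_inv_qPoch {p : ℂ} (hp : ‖p‖ < 1) :
    rescale p (PowerSeries.mk fun n => (qPoch p p n)⁻¹) =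
      (1 - X) * PowerSeries.mk fun n => (qPoch p p n)⁻¹ := by
  ext n
  cases n with
  | zero => simp [sub_mul]
  | succ n =>
    rw [coeff_rescale, sub_mul, one_mul, map_sub, coeff_succ_X_mul]
    simp only [coeff_mk]
    rw [← inv_qPoch_self_succ hp n]
    ring

open PowerSeries in
/-- The functional equation of `∑ xⁿ p^(n(n-1)/2) zⁿ / (p; p)_n` with `p = q²`. -/
theorem mk_eq_mul_rescale_mk {q : ℂ} (hp : ‖q ^ 2‖ < 1) (x : ℂ) :
    (PowerSeries.mk fun n => x ^ n * q ^ (n * (n - 1)) * (qPoch (q ^ 2) (q ^ 2) n)⁻¹) =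
      (1 + C x * X) * rescale (q ^ 2)
        (PowerSeries.mk fun n => x ^ n * q ^ (n * (n - 1)) * (qPoch (q ^ 2) (q ^ 2) n)⁻¹) := by
  ext n
  cases n with
  | zero =>
    rw [add_mul, one_mul, map_add, mul_assoc, coeff_C_mul, coeff_zero_X_mul, coeff_rescale]
    simp
  | succ n =>
    rw [add_mul, one_mul, map_add, mul_assoc, coeff_C_mul, coeff_succ_X_mul, coeff_rescale,
      coeff_rescale]
    simp only [coeff_mk]
    rw [← inv_qPoch_self_succ hp n]
    have h : (n + 1) * (n + 1 - 1) = n * (n - 1) + 2 * n := by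
      cases n <;> simp; ring
    rw [h, pow_add, pow_mul]
    ring

open PowerSeries in
/-- The finite `q`-binomial theorem. -/
theorem sum_antidiagonal_qBinomial {q : ℂ} (hp : ‖q ^ 2‖ < 1) (x : ℂ) (n : ℕ) :
    ∑ a ∈ Finset.HasAntidiagonal.antidiagonal n, x ^ a.1 * q ^ (a.1 * (a.1 - 1)) * (qPoch (q ^ 2) (q ^ 2) a.1)⁻¹ *
        (qPoch (q ^ 2) (q ^ 2) a.2)⁻¹ =
      qPoch (-x) (q ^ 2) n * (qPoch (q ^ 2) (q ^ 2) n)⁻¹ := by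
  set h := PowerSeries.mk fun n => x ^ n * q ^ (n * (n - 1)) * (qPoch (q ^ 2) (q ^ 2) n)⁻¹ with hh
  set f := PowerSeries.mk fun n => (qPoch (q ^ 2) (q ^ 2) n)⁻¹ with hf
  have hcoeff : ∀ n, coeff n (h * f) = ∑ a ∈ Finset.HasAntidiagonal.antidiagonal n, x ^ a.1 *
      q ^ (a.1 * (a.1 - 1)) * (qPoch (q ^ 2) (q ^ 2) a.1)⁻¹ * (qPoch (q ^ 2) (q ^ 2) a.2)⁻¹ := by
    intro n
    simp [coeff_mul, hh, hf]
  have hfun : (1 + C x * X) * rescale (q ^ 2) (h * f) = (1 - X) * (h * f) := by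
    rw [map_mul, rescale_mk_inv_qPoch hp, ← mul_assoc, ← mk_eq_mul_rescale_mk hp]
    ring
  rw [← hcoeff]
  clear_value h f
  induction n with
  | zero => rw [hcoeff]; simp [qPoch_zero]
  | succ n ih =>
    have h1 := congrArg (coeff (n + 1)) hfun
    rw [add_mul, sub_mul, one_mul, one_mul, map_add, map_sub, mul_assoc, coeff_C_mul,
      coeff_succ_X_mul, coeff_succ_X_mul, coeff_rescale, coeff_rescale, ih] at h1
    have h2 := one_sub_pow_succ_ne_zero hp n
    refine mul_right_cancel₀ h2 ?_
    rw [mul_assoc, inv_qPoch_self_succ hp n, qPoch_succ]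
    linear_combination -h1

open PowerSeries in
/-- The two-term recursion behind Gauss's evaluation of the alternating sum of Gaussian binomials. -/
theorem sum_antidiagonal_alternating {p : ℂ} (hp : ‖p‖ < 1) :
    ∀ n, ∑ a ∈ Finset.HasAntidiagonal.antidiagonal (2 * n),
        (-1) ^ a.2 * (qPoch p p a.1)⁻¹ * (qPoch p p a.2)⁻¹ = (qPoch (p ^ 2) (p ^ 2) n)⁻¹ ∧
      ∑ a ∈ Finset.HasAntidiagonal.antidiagonal (2 * n + 1),
        (-1) ^ a.2 * (qPoch p p a.1)⁻¹ * (qPoch p p a.2)⁻¹ = 0 := by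
  set f := PowerSeries.mk fun n => (qPoch p p n)⁻¹ with hf
  have hcoeff : ∀ n, coeff n (f * rescale (-1) f) = ∑ a ∈ Finset.HasAntidiagonal.antidiagonal n,
      (-1) ^ a.2 * (qPoch p p a.1)⁻¹ * (qPoch p p a.2)⁻¹ := by
    intro n
    simp only [coeff_mul, hf, coeff_rescale, coeff_mk]
    exact Finset.sum_congr rfl fun _ _ => by ring
  have hfp : rescale p f = (1 - X) * f := rescale_mk_inv_qPoch hp
  have hX : rescale (-1 : ℂ) X = -X := by
    ext n
    by_cases hn : n = 1 <;> simp [coeff_X, hn]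
  have hfun : rescale p (f * rescale (-1) f) = (1 - X * X) * (f * rescale (-1) f) := by
    rw [map_mul, hfp, rescale_rescale, mul_comm (-1) p, ← rescale_rescale, hfp, map_mul, map_sub,
      map_one, hX]
    ring
  set g := f * rescale (-1) f with hg
  have hrec : ∀ n, coeff (n + 2) g * (1 - p ^ (n + 2)) = coeff n g := by
    intro n
    have h1 := congrArg (coeff (n + 2)) hfun
    rw [sub_mul, one_mul, map_sub, mul_assoc, coeff_succ_X_mul, coeff_succ_X_mul,
      coeff_rescale] at h1
    linear_combination -h1
  simp only [← hcoeff]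
  intro n
  induction n with
  | zero =>
    refine ⟨by rw [hcoeff]; simp [qPoch_zero], ?_⟩
    rw [hcoeff, Finset.Nat.sum_antidiagonal_eq_sum_range_succ_mk]
    simp [Finset.sum_range_succ, qPoch_zero]
  | succ n ih =>
    constructor
    · refine mul_right_cancel₀ (one_sub_pow_succ_ne_zero hp (2 * n + 1)) ?_
      rw [show 2 * (n + 1) = 2 * n + 2 by ring, hrec, ih.1]
      have hp2 : ‖p ^ 2‖ < 1 := by
        rw [norm_pow]
        exact pow_lt_one₀ (norm_nonneg _) hp (by simp)
      rw [← inv_qPoch_self_succ hp2 n, ← pow_mul]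
      ring
    · refine mul_right_cancel₀ (one_sub_pow_succ_ne_zero hp (2 * n + 2)) ?_
      rw [show 2 * (n + 1) + 1 = 2 * n + 1 + 2 by ring, show 2 * n + 2 + 1 = 2 * n + 1 + 2 by ring,
        hrec, ih.2, zero_mul]

open Filter Topology in
theorem summable_pow_mul_pow_sq (c : ℝ) {t : ℝ} (ht0 : 0 ≤ t) (ht : t < 1) :
    Summable fun n : ℕ => c ^ n * t ^ n ^ 2 := by
  have h1 : Tendsto (fun n : ℕ => |c| * t ^ n) atTop (𝓝 0) := by
    simpa using (tendsto_pow_atTop_nhds_zero_of_lt_one ht0 ht).const_mul |c|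
  have h2 : ∀ᶠ n : ℕ in atTop, |c| * t ^ n ≤ 1 / 2 := h1.eventually_le_const (by norm_num)
  refine summable_of_isBigO_nat (g := fun n => (1 / 2 : ℝ) ^ n)
    (summable_geometric_of_lt_one (by norm_num) (by norm_num)) ?_
  refine Asymptotics.IsBigO.of_bound 1 ?_
  filter_upwards [h2] with n hn
  have h3 : 0 ≤ |c| * t ^ n := by positivity
  have h4 := pow_le_pow_left₀ h3 hn n
  rw [mul_pow, ← pow_mul, ← sq] at h4
  simpa [abs_mul, abs_of_nonneg ht0] using h4

theorem norm_sq_lt_one {q : ℂ} (hq : ‖q‖ < 1) : ‖q ^ 2‖ < 1 := by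
  rw [norm_pow]
  exact pow_lt_one₀ (norm_nonneg _) hq (by simp)

/-- The general term of Euler's expansion of `(wq; q²)_∞`. -/
noncomputable def eulerTerm (q w : ℂ) (m : ℕ) : ℂ :=
  (-w) ^ m * q ^ m ^ 2 * (qPoch (q ^ 2) (q ^ 2) m)⁻¹

theorem norm_eulerTerm_le {q : ℂ} (hq : ‖q‖ < 1) (w : ℂ) (m : ℕ) :
    ‖eulerTerm q w m‖ ≤ (‖w‖ * (1 - ‖q ^ 2‖)⁻¹) ^ m * ‖q‖ ^ m ^ 2 := by
  have h := norm_inv_qPoch_self_le (norm_sq_lt_one hq) m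
  rw [eulerTerm, norm_mul, norm_mul, norm_pow, norm_pow, norm_neg, mul_pow]
  calc _ ≤ ‖w‖ ^ m * ‖q‖ ^ m ^ 2 * ((1 - ‖q ^ 2‖)⁻¹) ^ m := by gcongr
    _ = _ := by ring

theorem summable_eulerTerm {q : ℂ} (hq : ‖q‖ < 1) (w : ℂ) : Summable (eulerTerm q w) :=
  Summable.of_norm_bounded (summable_pow_mul_pow_sq _ (norm_nonneg q) hq)
    (norm_eulerTerm_le hq w)

theorem tsum_eulerTerm_eq {q : ℂ} (hq : ‖q‖ < 1) (w : ℂ) :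
    ∑' m, eulerTerm q w m = (1 - w * q) * ∑' m, eulerTerm q (w * q ^ 2) m := by
  have hs := summable_eulerTerm hq w
  have hs2 := summable_eulerTerm hq (w * q ^ 2)
  have h1 : ∀ m, eulerTerm q w (m + 1) =
      eulerTerm q (w * q ^ 2) (m + 1) + -(w * q) * eulerTerm q (w * q ^ 2) m := by
    intro m
    simp only [eulerTerm]
    rw [← inv_qPoch_self_succ (norm_sq_lt_one hq) m]
    ring
  have hs3 := (summable_nat_add_iff 1).mpr hs2
  calc ∑' m, eulerTerm q w m
      = eulerTerm q w 0 + ∑' m, eulerTerm q w (m + 1) := hs.tsum_eq_zero_add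
    _ = eulerTerm q (w * q ^ 2) 0 + (∑' m, eulerTerm q (w * q ^ 2) (m + 1) +
          -(w * q) * ∑' m, eulerTerm q (w * q ^ 2) m) := by
        rw [tsum_congr h1, hs3.tsum_add (hs2.mul_left _), tsum_mul_left]
        simp [eulerTerm]
    _ = (1 - w * q) * ∑' m, eulerTerm q (w * q ^ 2) m := by
        rw [← add_assoc, ← hs2.tsum_eq_zero_add]
        ring

theorem tsum_eulerTerm_eq_qPoch_mul {q : ℂ} (hq : ‖q‖ < 1) (w : ℂ) (n : ℕ) :
    ∑' m, eulerTerm q w m =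
      qPoch (w * q) (q ^ 2) n * ∑' m, eulerTerm q (w * (q ^ 2) ^ n) m := by
  induction n with
  | zero => simp [qPoch_zero]
  | succ n ih =>
    rw [ih, tsum_eulerTerm_eq hq, qPoch_succ, pow_succ (q ^ 2) n]
    ring_nf

open Filter Topology in
/-- Euler's expansion `(wq; q²)_∞ = ∑ (-w)^m q^(m²) / (q²; q²)_m`. -/
theorem tsum_eulerTerm {q : ℂ} (hq : ‖q‖ < 1) (w : ℂ) :
    ∑' m, eulerTerm q w m = qPochInf (w * q) (q ^ 2) := by
  have hp := norm_sq_lt_one hq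
  have hpow : Tendsto (fun n : ℕ => (q ^ 2) ^ n) atTop (𝓝 0) :=
    tendsto_pow_atTop_nhds_zero_of_norm_lt_one hp
  have hmul : Multipliable fun k : ℕ => 1 - w * q * (q ^ 2) ^ k := by
    have h := multipliable_one_add_of_summable (f := fun k : ℕ => -(w * q * (q ^ 2) ^ k)) (by
      simp only [norm_neg, norm_mul, norm_pow (q ^ 2)]
      exact (summable_geometric_of_lt_one (norm_nonneg _) hp).mul_left _)
    simpa only [← sub_eq_add_neg] using h
  have hlim : Tendsto (fun n => qPoch (w * q) (q ^ 2) n) atTop (𝓝 (qPochInf (w * q) (q ^ 2))) :=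
    hmul.tendsto_prod_tprod_nat
  have hE : Tendsto (fun n : ℕ => ∑' m, eulerTerm q (w * (q ^ 2) ^ n) m) atTop
      (𝓝 (∑' m, eulerTerm q 0 m)) := by
    refine tendsto_tsum_of_dominated_convergence
      (summable_pow_mul_pow_sq (‖w‖ * (1 - ‖q ^ 2‖)⁻¹) (norm_nonneg q) hq) (fun m => ?_)
      (Eventually.of_forall fun n m => ?_)
    · have hw : Tendsto (fun n : ℕ => w * (q ^ 2) ^ n) atTop (𝓝 0) := by
        simpa using hpow.const_mul w
      have hc : Continuous fun u : ℂ => eulerTerm q u m := by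
        unfold eulerTerm
        fun_prop
      exact (hc.tendsto 0).comp hw
    · refine (norm_eulerTerm_le hq _ m).trans ?_
      have h0 : 0 ≤ (1 - ‖q ^ 2‖)⁻¹ := inv_nonneg.mpr (by linarith)
      have h1 : ‖w * (q ^ 2) ^ n‖ ≤ ‖w‖ := by
        rw [norm_mul, norm_pow (q ^ 2)]
        exact mul_le_of_le_one_right (norm_nonneg _) (pow_le_one₀ (norm_nonneg _) hp.le)
      gcongr
  have hE0 : ∑' m, eulerTerm q 0 m = 1 := by
    rw [tsum_eq_single 0 fun m hm => by simp [eulerTerm, hm]]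
    simp [eulerTerm, qPoch_zero]
  have h := hlim.mul hE
  simp only [← tsum_eulerTerm_eq_qPoch_mul hq w] at h
  rw [hE0, mul_one] at h
  exact tendsto_nhds_unique tendsto_const_nhds h

/-- The triple series obtained by expanding both sides of the identity. -/
noncomputable def tripleTerm (x y q : ℂ) (a : (ℕ × ℕ) × ℕ) : ℂ :=
  x ^ a.1.1 * q ^ (a.1.1 * (a.1.1 - 1)) * (qPoch (q ^ 2) (q ^ 2) a.1.1)⁻¹ *
    (qPoch (q ^ 2) (q ^ 2) a.1.2)⁻¹ * (qPoch (q ^ 2) (q ^ 2) a.2)⁻¹ * (-1) ^ a.2 *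
    (y ^ (a.1.1 + (a.1.2 + a.2)) * q ^ (a.1.1 + (a.1.2 + a.2)) ^ 2)

theorem summable_tripleTerm (x y : ℂ) {q : ℂ} (hq : ‖q‖ < 1) : Summable (tripleTerm x y q) := by
  have hp := norm_sq_lt_one hq
  set r := (1 - ‖q ^ 2‖)⁻¹ with hr
  have hr0 : 0 ≤ r := inv_nonneg.mpr (by linarith)
  have hs := summable_pow_mul_pow_sq (‖y‖ * r) (norm_nonneg q) hq
  have hs' := summable_pow_mul_pow_sq (‖x‖ * ‖y‖ * r) (norm_nonneg q) hq
  have hs3 := (hs'.mul_of_nonneg hs (fun _ => by positivity) fun _ => by positivity).mul_of_nonneg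
    hs (fun _ => by simp only [Pi.zero_apply]; positivity) fun _ => by
      simp only [Pi.zero_apply]; positivity
  refine Summable.of_norm_bounded hs3 ?_
  rintro ⟨⟨i, k⟩, m⟩
  have hi := norm_inv_qPoch_self_le hp i
  have hk := norm_inv_qPoch_self_le hp k
  have hm := norm_inv_qPoch_self_le hp m
  have hpow : ‖q‖ ^ (i * (i - 1)) ≤ 1 := pow_le_one₀ (norm_nonneg _) hq.le
  have hsq : ‖q‖ ^ (i + (k + m)) ^ 2 ≤ ‖q‖ ^ (i ^ 2 + k ^ 2 + m ^ 2) :=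
    pow_le_pow_of_le_one (norm_nonneg _) hq.le 
      (Nat.le.intro (k := 2 * (i * k + i * m + k * m)) (by ring))
  simp only [tripleTerm, norm_mul, norm_pow x, norm_pow y, norm_pow q (i * (i - 1)),
    norm_pow q ((i + (k + m)) ^ 2), norm_pow (-1 : ℂ), norm_neg, norm_one, one_pow, mul_one]
  calc _ ≤ ‖x‖ ^ i * 1 * r ^ i * r ^ k * r ^ m *
        (‖y‖ ^ (i + (k + m)) * ‖q‖ ^ (i ^ 2 + k ^ 2 + m ^ 2)) := by gcongr
    _ = _ := by ring

theorem tsum_tripleTerm_last {q : ℂ} (x y : ℂ) (a : ℕ × ℕ) :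
    ∑' m, tripleTerm x y q (a, m) =
      x ^ a.1 * q ^ (a.1 * (a.1 - 1)) * (qPoch (q ^ 2) (q ^ 2) a.1)⁻¹ *
        (qPoch (q ^ 2) (q ^ 2) a.2)⁻¹ * (y ^ (a.1 + a.2) * q ^ (a.1 + a.2) ^ 2 *
          ∑' m, eulerTerm q (y * (q ^ 2) ^ (a.1 + a.2)) m) := by
  rw [← mul_assoc, ← tsum_mul_left]
  refine tsum_congr fun m => ?_
  simp only [tripleTerm, eulerTerm]
  rw [neg_pow (y * _)]
  ring

theorem tsum_tripleTerm_eq_right (x y : ℂ) {q : ℂ} (hq : ‖q‖ < 1)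
    (hy : ∀ k : ℕ, y * q ^ (2 * k + 1) ≠ 1) :
    ∑' a, tripleTerm x y q a = qPochInf (y * q) (q ^ 2) *
        ∑' j : ℕ, qPoch (-x) (q ^ 2) j * y ^ j * q ^ (j ^ 2) /
            (qPoch (y * q) (q ^ 2) j * qPoch (q ^ 2) (q ^ 2) j) := by
  have hs := summable_tripleTerm x y hq
  have h := hs.prod.hasSum.sum_fiberwise_finset (fun a : ℕ × ℕ => a.1 + a.2) Finset.HasAntidiagonal.antidiagonal
    fun c b => Finset.HasAntidiagonal.mem_antidiagonal
  rw [hs.tsum_prod, ← h.tsum_eq, ← tsum_mul_left]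
  refine tsum_congr fun j => ?_
  have hne : qPoch (y * q) (q ^ 2) j ≠ 0 := by
    rw [qPoch, Finset.prod_ne_zero_iff]
    intro k _ h0
    refine hy k ?_
    rw [pow_succ, pow_mul]
    linear_combination -h0
  calc _ = ∑ a ∈ Finset.HasAntidiagonal.antidiagonal j, x ^ a.1 * q ^ (a.1 * (a.1 - 1)) *
        (qPoch (q ^ 2) (q ^ 2) a.1)⁻¹ * (qPoch (q ^ 2) (q ^ 2) a.2)⁻¹ *
          (y ^ j * q ^ j ^ 2 * ∑' m, eulerTerm q (y * (q ^ 2) ^ j) m) := by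
        refine Finset.sum_congr rfl fun a ha => ?_
        rw [tsum_tripleTerm_last, Finset.HasAntidiagonal.mem_antidiagonal.mp ha]
    _ = _ := by
        rw [← Finset.sum_mul, sum_antidiagonal_qBinomial (norm_sq_lt_one hq), ← tsum_eulerTerm hq,
          tsum_eulerTerm_eq_qPoch_mul hq y j]
        have h0 := qPoch_self_ne_zero (norm_sq_lt_one hq) j
        generalize qPoch (y * q) (q ^ 2) j = A at hne ⊢
        field_simp

theorem tsum_tripleTerm_eq_left (x y : ℂ) {q : ℂ} (hq : ‖q‖ < 1) :
    ∑' a, tripleTerm x y q a = ∑' p : ℕ × ℕ,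
        x ^ p.1 * y ^ (p.1 + 2 * p.2) *
          q ^ (2 * p.1 ^ 2 + 4 * p.2 ^ 2 + 4 * p.1 * p.2 - p.1) /
          (qPoch (q ^ 2) (q ^ 2) p.1 * qPoch (q ^ 4) (q ^ 4) p.2) := by
  have hs := summable_tripleTerm x y hq
  have h := hs.hasSum.sum_fiberwise_finset (fun a : (ℕ × ℕ) × ℕ => (a.1.1, a.1.2 + a.2))
    (fun c => (({c.1} : Finset ℕ) ×ˢ Finset.HasAntidiagonal.antidiagonal c.2).map
      (Equiv.prodAssoc ℕ ℕ ℕ).symm.toEmbedding) (by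
      rintro ⟨i, n⟩ ⟨⟨i', k⟩, m⟩
      simp [and_comm, eq_comm])
  have hterm : ∀ i n, ∑ b ∈ Finset.HasAntidiagonal.antidiagonal n, tripleTerm x y q ((i, b.1), b.2) =
      x ^ i * q ^ (i * (i - 1)) * (qPoch (q ^ 2) (q ^ 2) i)⁻¹ * (y ^ (i + n) * q ^ (i + n) ^ 2) *
        ∑ b ∈ Finset.HasAntidiagonal.antidiagonal n, (-1) ^ b.2 * (qPoch (q ^ 2) (q ^ 2) b.1)⁻¹ *
          (qPoch (q ^ 2) (q ^ 2) b.2)⁻¹ := by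
    intro i n
    rw [Finset.mul_sum]
    refine Finset.sum_congr rfl fun b hb => ?_
    simp only [tripleTerm, Finset.HasAntidiagonal.mem_antidiagonal.mp hb]
    ring
  simp only [Finset.sum_map, Finset.sum_product, Finset.sum_singleton, Equiv.coe_toEmbedding,
    Equiv.prodAssoc_symm_apply, hterm] at h
  have halt := sum_antidiagonal_alternating (norm_sq_lt_one hq)
  have hinj : Function.Injective fun p : ℕ × ℕ => (p.1, 2 * p.2) := by
    rintro ⟨i, j⟩ ⟨i', j'⟩ hij
    simpa using hij
  rw [← h.tsum_eq, ← hinj.tsum_eq]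
  · refine tsum_congr fun ⟨i, j⟩ => ?_
    have hexp : 2 * i ^ 2 + 4 * j ^ 2 + 4 * i * j - i = i * (i - 1) + (i + 2 * j) ^ 2 := by
      have h1 : i * (i - 1) + i = i ^ 2 := by
        cases i <;> simp; ring
      have h2 : (i + 2 * j) ^ 2 = i ^ 2 + 4 * j ^ 2 + 4 * i * j := by ring
      omega
    simp only [(halt j).1, hexp, ← pow_mul, pow_add q, div_eq_mul_inv, mul_inv]
    ring
  · rintro ⟨i, n⟩ hn
    obtain ⟨j, rfl | rfl⟩ := n.even_or_odd'
    · exact ⟨(i, j), rfl⟩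
    · refine absurd ?_ hn
      simp only [(halt j).2, mul_zero]

theorem stmt_11 (x y q : ℂ) (hq : ‖q‖ < 1)
    (hy : ∀ k : ℕ, y * q ^ (2 * k + 1) ≠ 1) :
    (∑' p : ℕ × ℕ,
        x ^ p.1 * y ^ (p.1 + 2 * p.2) *
          q ^ (2 * p.1 ^ 2 + 4 * p.2 ^ 2 + 4 * p.1 * p.2 - p.1) /
          (qPoch (q ^ 2) (q ^ 2) p.1 * qPoch (q ^ 4) (q ^ 4) p.2))
      = qPochInf (y * q) (q ^ 2) *
        ∑' j : ℕ,
          qPoch (-x) (q ^ 2) j * y ^ j * q ^ (j ^ 2) /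
            (qPoch (y * q) (q ^ 2) j * qPoch (q ^ 2) (q ^ 2) j) := by
  rw [← tsum_tripleTerm_eq_left x y hq, tsum_tripleTerm_eq_right x y hq hy]
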